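/- arXiv:2012.14079 — 2 statements merged into one kernel-verified Lean document; each statement's English description precedes it below -/
import Mathlib

section
/- Let S be a 2-factor of G that is not a tour, containing the path P = {(v1,v2), (v2,v3), (v3,v4)} (v1, v2, v3, v4 distinct) in a cycle C* of S, and let v0, v5 ∈ V(C*) satisfy (v0,v1), (v4,v5) ∈ C*, v0 ≠ v2 and v5 ≠ v3. Let T be a path cover of G with (v1,v2), (v2,v3) ∈ T and V1(T) = V \ {v2}, let C** be a cycle of S distinct from C*, and let f ∈ C** \ T be an edge with endpoint q such that T ∪ {f} is a path cover of G. Then there exist four path covers S1, S2, T1, T2 of G such that: (a) S_i ∪ T_i = S ∪ T and S_i ∩ T_i = S ∩ T for i = 1,2; (b) V1(S_i) and V1(T_i) form a partition of V \ {v2} for i = 1,2; (c) T1 \ T2 = {(v3,v4)}, T2 \ T1 = {(v0,v1)}, and the two-edge path {(v1,v2), (v2,v3)} belongs to 𝒫(T1 ∩ T2); and (d) q ∈ V1(S1) ∩ V1(S2). -/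
variable {V : Type*} [Fintype V] [DecidableEq V]

/-- The degree of vertex `v` in the edge set `F`. -/
def degE (F : Finset (Sym2 V)) (v : V) : ℕ := (F.filter (fun e => v ∈ e)).card

/-- The set of vertices incident to an edge of `F`. -/
def VsetE (F : Finset (Sym2 V)) : Set V := {v | ∃ e ∈ F, v ∈ e}

/-- Vertices incident to exactly one edge of `F`. -/
def V1E (F : Finset (Sym2 V)) : Set V := {v | degE F v = 1}

/-- Vertices incident to exactly two edges of `F`. -/
def V2E (F : Finset (Sym2 V)) : Set V := {v | degE F v = 2}

/-- All edges are genuine edges of the complete graph (no loops). -/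
def SimpleE (F : Finset (Sym2 V)) : Prop := ∀ e ∈ F, ¬ e.IsDiag

/-- `F` is spanning: every vertex is incident to an edge of `F`. -/
def SpanningE (F : Finset (Sym2 V)) : Prop := VsetE F = Set.univ

/-- `F` is a `k`-matching: every vertex has at most `k` incident edges. -/
def IsKMatching (k : ℕ) (F : Finset (Sym2 V)) : Prop :=
  SimpleE F ∧ ∀ v : V, degE F v ≤ k

/-- `F` is a `k`-factor: every vertex has exactly `k` incident edges. -/
def IsKFactor (k : ℕ) (F : Finset (Sym2 V)) : Prop :=
  SimpleE F ∧ ∀ v : V, degE F v = k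

/-- `F` is the edge set of a single (simple) cycle. -/
def IsCycleE (F : Finset (Sym2 V)) : Prop :=
  ∃ m : ℕ, 3 ≤ m ∧ ∃ f : ℕ → V,
    (∀ i < m, ∀ j < m, f i = f j → i = j) ∧
    F = (Finset.range m).image (fun i => s(f i, f ((i + 1) % m)))

/-- `F` contains no cycle. -/
def AcyclicE (F : Finset (Sym2 V)) : Prop :=
  ∀ C : Finset (Sym2 V), C ⊆ F → ¬ IsCycleE C

/-- `F` is the edge set of a simple path with endpoints `a` and `b`. -/
def IsPathE (F : Finset (Sym2 V)) (a b : V) : Prop :=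
  ∃ m : ℕ, 1 ≤ m ∧ ∃ f : ℕ → V,
    (∀ i ≤ m, ∀ j ≤ m, f i = f j → i = j) ∧ f 0 = a ∧ f m = b ∧
    F = (Finset.range m).image (fun i => s(f i, f (i + 1)))

/-- `P` is a maximal path of `F`, i.e. `P ∈ 𝒫(F)`. -/
def MaxPathE (F P : Finset (Sym2 V)) : Prop :=
  P ⊆ F ∧ (∃ a b : V, IsPathE P a b) ∧
  ∀ e ∈ F, (∃ v : V, v ∈ e ∧ v ∈ VsetE P) → e ∈ P

/-- `F` is a path cover: a spanning acyclic 2-matching. -/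
def IsPathCoverE (F : Finset (Sym2 V)) : Prop :=
  IsKMatching 2 F ∧ SpanningE F ∧ AcyclicE F

/-- `F` is a tour: the edge set of a Hamiltonian cycle. -/
def IsTourE (F : Finset (Sym2 V)) : Prop :=
  IsCycleE F ∧ SpanningE F

/-- Total length of the edge set `F`. -/
def lenE (ℓ : Sym2 V → ℝ) (F : Finset (Sym2 V)) : ℝ := ∑ e ∈ F, ℓ e

/-- Minimum length of a tour. -/
noncomputable def optE (ℓ : Sym2 V → ℝ) : ℝ :=
  sInf {x | ∃ H : Finset (Sym2 V), IsTourE H ∧ lenE ℓ H = x}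

/-- Maximum length of a tour. -/
noncomputable def worE (ℓ : Sym2 V → ℝ) : ℝ :=
  sSup {x | ∃ H : Finset (Sym2 V), IsTourE H ∧ lenE ℓ H = x}

/-- The set of edges of `F` incident to `v`. -/
def deltaE (F : Finset (Sym2 V)) (v : V) : Finset (Sym2 V) :=
  F.filter (fun e => v ∈ e)

/-- `(S, T)` is a valid pair of spanning 2-matchings. -/
def ValidPairE (S T : Finset (Sym2 V)) : Prop :=
  IsKMatching 2 S ∧ IsKMatching 2 T ∧ SpanningE S ∧ SpanningE T ∧
  AcyclicE T ∧
  (∀ v : V, v ∈ V2E S → v ∈ V2E T → deltaE S v = deltaE T v) ∧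
  (∀ C : Finset (Sym2 V), C ⊆ S → IsCycleE C →
    ∀ P : Finset (Sym2 V), MaxPathE T P → VsetE C ≠ VsetE P)


section

variable {W : Type*} [DecidableEq W]

lemma degE_insert {F : Finset (Sym2 W)} {e : Sym2 W} (he : e ∉ F) (v : W) :
    degE (insert e F) v = degE F v + if v ∈ e then 1 else 0 := by
  unfold degE
  rw [Finset.filter_insert]
  split_ifs with h
  · rw [Finset.card_insert_of_notMem (by simp [he])]
  · rfl

lemma degE_union {F F' : Finset (Sym2 W)} (h : Disjoint F F') (v : W) :
    degE (F ∪ F') v = degE F v + degE F' v := by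
  unfold degE
  rw [Finset.filter_union, Finset.card_union_of_disjoint (Finset.disjoint_filter_filter h)]

lemma degE_sdiff {F F' : Finset (Sym2 W)} (h : F' ⊆ F) (v : W) :
    degE (F \ F') v + degE F' v = degE F v := by
  rw [← degE_union Finset.sdiff_disjoint, Finset.sdiff_union_of_subset h]

lemma degE_pos_iff {F : Finset (Sym2 W)} {v : W} : 0 < degE F v ↔ v ∈ VsetE F := by
  simp [degE, VsetE, Finset.card_pos, Finset.Nonempty]

lemma degE_eq_zero {F : Finset (Sym2 W)} {v : W} (h : ∀ e ∈ F, v ∉ e) : degE F v = 0 := by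
  simpa [degE, Finset.filter_eq_empty_iff] using h

/-- A vertex of degree at most one lies on at most one edge. -/
lemma eq_of_degE_le_one {F : Finset (Sym2 W)} {v : W} (h : degE F v ≤ 1) {a b : Sym2 W}
    (ha : a ∈ F) (hva : v ∈ a) (hb : b ∈ F) (hvb : v ∈ b) : a = b :=
  Finset.card_le_one.1 h a (by simp [ha, hva]) b (by simp [hb, hvb])

/-- Two distinct edges at a vertex of degree at most two are the only ones. -/
lemma eq_or_eq_of_degE_le_two {F : Finset (Sym2 W)} {v : W} (h : degE F v ≤ 2) {a b e : Sym2 W}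
    (hab : a ≠ b) (ha : a ∈ F) (hva : v ∈ a) (hb : b ∈ F) (hvb : v ∈ b)
    (he : e ∈ F) (hve : v ∈ e) : e = a ∨ e = b := by
  by_contra! hc
  have hsub : ({e, a, b} : Finset (Sym2 W)) ⊆ F.filter (fun e => v ∈ e) := by
    intro x hx
    simp only [Finset.mem_insert, Finset.mem_singleton] at hx
    rcases hx with rfl | rfl | rfl <;> simp [*]
  have := Finset.card_le_card hsub
  rw [Finset.card_eq_three.2 ⟨e, a, b, hc.1, hc.2, hab, rfl⟩] at this
  unfold degE at h
  omega

/-- A cycle is traversed by a sequence of period `m` that is injective on each period. -/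
lemma IsCycleE.exists_periodic {C : Finset (Sym2 W)} (hC : IsCycleE C) :
    ∃ m : ℕ, 3 ≤ m ∧ ∃ g : ℕ → W, (∀ i j, g i = g j ↔ i ≡ j [MOD m]) ∧
      ∀ e, e ∈ C ↔ ∃ i < m, e = s(g i, g (i + 1)) := by
  obtain ⟨m, hm, f, hf, rfl⟩ := hC
  refine ⟨m, hm, fun i => f (i % m), fun i j => ⟨fun h => ?_, fun h => ?_⟩, fun e => ?_⟩
  · exact hf _ (Nat.mod_lt _ (by omega)) _ (Nat.mod_lt _ (by omega)) h
  · exact congrArg f h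
  · simp only [Finset.mem_image, Finset.mem_range]
    constructor
    · rintro ⟨i, hi, rfl⟩
      exact ⟨i, hi, by rw [Nat.mod_eq_of_lt hi]⟩
    · rintro ⟨i, hi, rfl⟩
      exact ⟨i, hi, by rw [Nat.mod_eq_of_lt hi]⟩

/-- A labelling that is constant along all edges of a cycle but one is constant on the cycle. -/
lemma IsCycleE.label_eq {C : Finset (Sym2 W)} (hC : IsCycleE C) {L : Type*} {c : W → L}
    {e : Sym2 W} (he : e ∈ C) (hc : ∀ x y, s(x, y) ∈ C → s(x, y) ≠ e → c x = c y)
    {x y : W} (hx : x ∈ VsetE C) (hy : y ∈ VsetE C) : c x = c y := by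
  obtain ⟨m, hm, g, hg, hmem⟩ := hC.exists_periodic
  obtain ⟨i, hi, rfl⟩ := (hmem e).1 he
  have hedge : ∀ j, s(g j, g (j + 1)) ∈ C := fun j =>
    (hmem _).2 ⟨j % m, Nat.mod_lt _ (by omega), by
      rw [(hg (j % m) j).2 (Nat.mod_modEq _ _),
        (hg (j % m + 1) (j + 1)).2 ((Nat.mod_modEq _ _).add_right 1)]⟩
  have hstep : ∀ k, k < m → c (g (i + 1 + k)) = c (g (i + 1)) := by
    intro k
    induction k with
    | zero => simp
    | succ k ih =>
      intro hk
      rw [← ih (by omega)]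
      refine (hc _ _ (hedge (i + 1 + k)) ?_).symm
      rw [Ne, Sym2.eq_iff]
      rintro (⟨h, -⟩ | ⟨h, h'⟩)
      · have h1 : 0 + i ≡ (k + 1) + i [MOD m] := by
          have := ((hg _ _).1 h).symm
          convert this using 1 <;> ring
        have := Nat.ModEq.add_right_cancel' _ h1
        rw [Nat.ModEq, Nat.zero_mod, Nat.mod_eq_of_lt hk] at this
        omega
      · have h1 : 0 + (i + 1) ≡ k + (i + 1) [MOD m] := by
          have := ((hg _ _).1 h).symm
          convert this using 1 <;> ring
        have h2 : 0 + i ≡ (k + 2) + i [MOD m] := by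
          have := ((hg _ _).1 h').symm
          convert this using 1; ring
          ring
        have h1 := Nat.ModEq.add_right_cancel' _ h1
        have h2 := Nat.ModEq.add_right_cancel' _ h2
        rw [Nat.ModEq, Nat.zero_mod, Nat.mod_eq_of_lt (by omega)] at h1
        rw [Nat.ModEq, Nat.zero_mod, Nat.mod_eq_of_lt (by omega)] at h2
        omega
  have hall : ∀ j, c (g j) = c (g (i + 1)) := by
    intro j
    rw [← hstep ((j + (m * (i + 1) - (i + 1))) % m) (Nat.mod_lt _ (by omega))]
    congr 1
    rw [hg]
    have hle : i + 1 ≤ m * (i + 1) := Nat.le_mul_of_pos_left _ (by omega)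
    calc j ≡ j + m * (i + 1) [MOD m] := by simp [Nat.ModEq]
      _ = i + 1 + (j + (m * (i + 1) - (i + 1))) := by omega
      _ ≡ _ [MOD m] := (Nat.mod_modEq _ _).symm.add_left _
  have hv : ∀ x ∈ VsetE C, c x = c (g (i + 1)) := by
    rintro x ⟨e, he, hxe⟩
    obtain ⟨j, -, rfl⟩ := (hmem e).1 he
    rcases Sym2.mem_iff.1 hxe with rfl | rfl <;> exact hall _
  rw [hv x hx, hv y hy]

lemma IsCycleE.exists_two_neighbors {C : Finset (Sym2 W)} (hC : IsCycleE C) {x : W}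
    (hx : x ∈ VsetE C) : ∃ w w', w ≠ x ∧ w' ≠ x ∧ w ≠ w' ∧ s(x, w) ∈ C ∧ s(x, w') ∈ C := by
  obtain ⟨m, hm, f, hf, rfl⟩ := hC
  have hi : ∃ i < m, f i = x := by
    obtain ⟨e, he, hxe⟩ := hx
    simp only [Finset.mem_image, Finset.mem_range] at he
    obtain ⟨i, hi, rfl⟩ := he
    rcases Sym2.mem_iff.1 hxe with rfl | rfl
    · exact ⟨i, hi, rfl⟩
    · exact ⟨_, Nat.mod_lt _ (by omega), rfl⟩
  obtain ⟨i, hi, rfl⟩ := hi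
  have hne : ∀ a < m, ∀ b < m, a ≠ b → f a ≠ f b := fun a ha b hb hab h => hab (hf a ha b hb h)
  have key : ∃ p < m, (p + 1) % m = i ∧ p ≠ i ∧ (i + 1) % m ≠ i ∧ (i + 1) % m ≠ p := by
    have hs : (i + 1) % m = if i + 1 = m then 0 else i + 1 := by
      split_ifs with h
      · rw [h, Nat.mod_self]
      · exact Nat.mod_eq_of_lt (by omega)
    rw [hs]
    by_cases h0 : i = 0
    · refine ⟨m - 1, by omega, ?_, by omega, by split_ifs <;> omega, by split_ifs <;> omega⟩
      rw [Nat.sub_add_cancel (by omega), Nat.mod_self, h0]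
    · refine ⟨i - 1, by omega, ?_, by omega, by split_ifs <;> omega, by split_ifs <;> omega⟩
      rw [Nat.sub_add_cancel (by omega), Nat.mod_eq_of_lt hi]
  obtain ⟨p, hp, hpi, h1, h2, h3⟩ := key
  have hlt : (i + 1) % m < m := Nat.mod_lt _ (by omega)
  refine ⟨f ((i + 1) % m), f p, hne _ hlt _ hi h2, hne _ hp _ hi h1, hne _ hlt _ hp h3, ?_, ?_⟩
  · exact Finset.mem_image.2 ⟨i, Finset.mem_range.2 hi, rfl⟩
  · exact Finset.mem_image.2 ⟨p, Finset.mem_range.2 hp, by rw [hpi, Sym2.eq_swap]⟩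

lemma IsCycleE.nonempty {C : Finset (Sym2 W)} (hC : IsCycleE C) : C.Nonempty := by
  obtain ⟨m, hm, f, -, rfl⟩ := hC
  simpa using by omega

/-- A cycle in a 2-matching contains all edges at its vertices. -/
lemma IsCycleE.mem_of_touch {S C : Finset (Sym2 W)} (hS : ∀ v, degE S v ≤ 2) (hC : IsCycleE C)
    (hCS : C ⊆ S) {x : W} (hx : x ∈ VsetE C) {e : Sym2 W} (he : e ∈ S) (hxe : x ∈ e) : e ∈ C := by
  obtain ⟨w, w', -, -, hww, h1, h2⟩ := hC.exists_two_neighbors hx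
  rcases eq_or_eq_of_degE_le_two (hS x) (a := s(x, w)) (b := s(x, w')) (by grind)
    (hCS h1) (by simp) (hCS h2) (by simp) he hxe with rfl | rfl <;> assumption

lemma IsCycleE.subset_of_touch {S C D : Finset (Sym2 W)} (hS : ∀ v, degE S v ≤ 2)
    (hC : IsCycleE C) (hCS : C ⊆ S) (hD : IsCycleE D) (hDS : D ⊆ S) {x : W}
    (hxC : x ∈ VsetE C) (hxD : x ∈ VsetE D) : C ⊆ D := by
  have hlab : ∀ a b, s(a, b) ∈ C → (a ∈ VsetE D ↔ b ∈ VsetE D) := by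
    intro a b hab
    constructor <;> intro h
    · exact ⟨_, hD.mem_of_touch hS hDS h (hCS hab) (by simp), by simp⟩
    · exact ⟨_, hD.mem_of_touch hS hDS h (hCS hab) (by simp), by simp⟩
  intro e he
  obtain ⟨a, b⟩ := e
  have ha : a ∈ VsetE C := ⟨_, he, Sym2.mem_mk_left a b⟩
  have := hC.label_eq (c := fun v => v ∈ VsetE D) he
    (fun x y hxy _ => propext (hlab x y hxy)) hxC ha
  exact hD.mem_of_touch hS hDS (this ▸ hxD) (hCS he) (Sym2.mem_mk_left a b)

/-- Two cycles in a 2-matching that share a vertex are equal. -/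
lemma IsCycleE.eq_of_touch {S C D : Finset (Sym2 W)} (hS : ∀ v, degE S v ≤ 2)
    (hC : IsCycleE C) (hCS : C ⊆ S) (hD : IsCycleE D) (hDS : D ⊆ S) {x : W}
    (hxC : x ∈ VsetE C) (hxD : x ∈ VsetE D) : C = D :=
  (hC.subset_of_touch hS hCS hD hDS hxC hxD).antisymm (hD.subset_of_touch hS hDS hC hCS hxD hxC)

/-- `c` is constant along the edges of `F`, and no label is shared by three vertices of degree
at most one. For a path cover, labelling by connected components has this property. -/
def IsPathLabel (F : Finset (Sym2 W)) {L : Type*} (c : W → L) : Prop :=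
  (∀ x y, s(x, y) ∈ F → c x = c y) ∧
  ∀ x y z, x ≠ y → y ≠ z → x ≠ z → degE F x ≤ 1 → degE F y ≤ 1 → degE F z ≤ 1 →
    ¬ (c x = c y ∧ c y = c z)

lemma AcyclicE.insert {F : Finset (Sym2 W)} {L : Type*} {c : W → L} {u w : W}
    (hF : AcyclicE F) (hc : ∀ x y, s(x, y) ∈ F → c x = c y) (huw : c u ≠ c w) :
    AcyclicE (insert s(u, w) F) := by
  intro C hCF hC
  by_cases he : s(u, w) ∈ C
  · refine huw (hC.label_eq he (fun x y hxy hne => hc x y ?_) ⟨_, he, by simp⟩ ⟨_, he, by simp⟩)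
    exact (Finset.mem_insert.1 (hCF hxy)).resolve_left hne
  · exact hF C ((Finset.subset_insert_iff_of_notMem he).1 hCF) hC

lemma IsPathLabel.insert {F : Finset (Sym2 W)} {L : Type*} [DecidableEq L] {c : W → L} {u w : W}
    (h : IsPathLabel F c) (huw : c u ≠ c w) (hu : degE F u = 1) (hw : degE F w = 1) :
    IsPathLabel (insert s(u, w) F) (fun v => if c v = c w then c u else c v) := by
  have hnot : s(u, w) ∉ F := fun hm => huw (h.1 u w hm)
  have hdeg : ∀ x, degE (Insert.insert s(u, w) F) x ≤ 1 → degE F x ≤ 1 ∧ x ≠ u ∧ x ≠ w := by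
    intro x hx
    rw [degE_insert hnot] at hx
    refine ⟨by omega, ?_, ?_⟩ <;> rintro rfl <;> simp at hx <;> omega
  refine ⟨fun x y hxy => ?_, fun x y z hxy hyz hxz hx hy hz => ?_⟩
  · rcases Finset.mem_insert.1 hxy with hxy | hxy
    · rcases Sym2.eq_iff.1 hxy with ⟨rfl, rfl⟩ | ⟨rfl, rfl⟩ <;> simp
    · simp [h.1 x y hxy]
  · obtain ⟨hx, hxu, hxw⟩ := hdeg x hx
    obtain ⟨hy, hyu, hyw⟩ := hdeg y hy
    obtain ⟨hz, hzu, hzw⟩ := hdeg z hz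
    have key : ∀ t, degE F t ≤ 1 → ∀ a b, a ≠ b → a ≠ t → b ≠ t → degE F a ≤ 1 → degE F b ≤ 1 →
        ¬ (c a = c t ∧ c b = c t) := fun t ht a b hab hat hbt ha hb hh =>
      h.2 a b t hab hbt hat ha hb ht ⟨hh.1.trans hh.2.symm, hh.2⟩
    have h0 := h.2 x y z hxy hyz hxz hx hy hz
    have u1 := key u hu.le x y hxy hxu hyu hx hy
    have u2 := key u hu.le y z hyz hyu hzu hy hz
    have u3 := key u hu.le x z hxz hxu hzu hx hz
    have w1 := key w hw.le x y hxy hxw hyw hx hy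
    have w2 := key w hw.le y z hyz hyw hzw hy hz
    have w3 := key w hw.le x z hxz hxw hzw hx hz
    dsimp only
    grind

/-- A spanning 2-matching that is a perfect matching except for a component `v1 - v2 - v3` has a
path label, which separates the ends of any further edge avoiding that component. -/
lemma exists_isPathLabel {T : Finset (Sym2 W)} {v1 v2 v3 : W} (hT : IsKMatching 2 T)
    (h13 : v1 ≠ v3) (h12 : v1 ≠ v2) (h32 : v3 ≠ v2)
    (hT12 : s(v1, v2) ∈ T) (hT23 : s(v2, v3) ∈ T) (hone : ∀ v, v ≠ v2 → degE T v = 1) :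
    ∃ c : W → Finset (Sym2 W), IsPathLabel T c ∧
      ∀ a b, a ≠ b → s(a, b) ∉ T → a ≠ v1 → a ≠ v2 → a ≠ v3 → b ≠ v1 → b ≠ v2 → b ≠ v3 →
        c a ≠ c b := by
  have hmem : ∀ v e, e ∈ deltaE T v ↔ e ∈ T ∧ v ∈ e := fun v e => by simp [deltaE]
  have hdelta : ∀ v, v ≠ v2 → ∃ e, deltaE T v = {e} ∧ e ∈ T ∧ v ∈ e := by
    intro v hv
    obtain ⟨e, he⟩ := Finset.card_eq_one.1 (hone v hv)
    have he' : deltaE T v = {e} := he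
    exact ⟨e, he', (hmem v e).1 (by simp [he'])⟩
  have hcomp : ∀ x y, s(x, y) ∈ T → (x = v1 ∨ x = v2 ∨ x = v3) → (y = v1 ∨ y = v2 ∨ y = v3) := by
    rintro x y hxy (rfl | rfl | rfl)
    · have := eq_of_degE_le_one (hone x h12).le hxy (by simp) hT12 (by simp)
      grind
    · have := eq_or_eq_of_degE_le_two (hT.2 x) (a := s(v1, x)) (b := s(x, v3))
        (by grind) hT12 (by simp) hT23 (by simp) hxy (by simp)
      grind
    · have := eq_of_degE_le_one (hone x h32).le hxy (by simp) hT23 (by simp)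
      grind
  refine ⟨fun v => if v = v1 ∨ v = v2 ∨ v = v3 then ∅ else deltaE T v, ⟨?_, ?_⟩, ?_⟩
  · intro x y hxy
    have hyx : s(y, x) ∈ T := by rwa [Sym2.eq_swap]
    dsimp only
    by_cases hx : x = v1 ∨ x = v2 ∨ x = v3
    · rw [if_pos hx, if_pos (hcomp x y hxy hx)]
    · have hy : ¬ (y = v1 ∨ y = v2 ∨ y = v3) := fun hy => hx (hcomp y x hyx hy)
      rw [if_neg hx, if_neg hy]
      obtain ⟨e, he, -⟩ := hdelta x (by tauto)
      obtain ⟨e', he', -⟩ := hdelta y (by tauto)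
      have h1 : s(x, y) ∈ deltaE T x := (hmem _ _).2 ⟨hxy, by simp⟩
      have h2 : s(x, y) ∈ deltaE T y := (hmem _ _).2 ⟨hxy, by simp⟩
      rw [he] at h1 ⊢
      rw [he'] at h2 ⊢
      rw [← Finset.mem_singleton.1 h1, ← Finset.mem_singleton.1 h2]
  · rintro x y z hxy hyz hxz hx hy hz ⟨e1, e2⟩
    have hne2 : ∀ x, degE T x ≤ 1 → x ≠ v2 := by
      rintro x hx rfl
      have := eq_of_degE_le_one hx hT12 (by simp) hT23 (by simp)
      grind
    have hx2 := hne2 x hx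
    have hy2 := hne2 y hy
    have hz2 := hne2 z hz
    obtain ⟨ex, dx, -, mx⟩ := hdelta x hx2
    obtain ⟨ey, dy, -, my⟩ := hdelta y hy2
    obtain ⟨ez, dz, -, mz⟩ := hdelta z hz2
    simp only [dx, dy, dz] at e1 e2
    have hb : ∀ e : Sym2 W, x ∈ e → y ∈ e → z ∈ e → False := by
      rintro ⟨a, b⟩ h1 h2 h3
      simp only [Sym2.mem_iff] at h1 h2 h3
      grind
    have hn : ∀ e : Sym2 W, (∅ : Finset (Sym2 W)) ≠ {e} := fun e =>
      (Finset.singleton_ne_empty e).symm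
    split_ifs at e1 e2 with i1 i2 i3 i3
    · grind
    · exact hn _ e2
    · exact hn _ e1
    · exact hn _ e1
    · exact hn _ e1.symm
    · exact hn _ e1.symm
    · exact hn _ e2.symm
    · rw [Finset.singleton_inj] at e1 e2
      subst e1 e2
      exact hb _ mx my mz
  · intro a b hab habT a1 a2 a3 b1 b2 b3
    dsimp only
    rw [if_neg (by tauto), if_neg (by tauto)]
    obtain ⟨e, he, hemT, hae⟩ := hdelta a a2
    obtain ⟨e', he', -, hbe⟩ := hdelta b b2
    rw [he, he', Ne, Finset.singleton_inj]
    rintro rfl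
    exact habT ((Sym2.mem_and_mem_iff hab).1 ⟨hae, hbe⟩ ▸ hemT)

/-- Moving a matching `N` from a 2-factor `S` to `T` so that both parts become acyclic. -/
lemma isPathCoverE_exchange {S T N : Finset (Sym2 W)} {v2 : W} (hS : IsKFactor 2 S)
    (hT : IsKMatching 2 T) (hT2 : degE T v2 = 2) (hone : ∀ v, v ≠ v2 → degE T v = 1)
    (hNS : N ⊆ S) (hNT : Disjoint T N) (hN : ∀ v, degE N v ≤ 1) (hN2 : degE N v2 = 0)
    (hmeet : ∀ C, IsCycleE C → C ⊆ S → ∃ e ∈ N, e ∈ C) (hac : AcyclicE (T ∪ N)) :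
    IsPathCoverE (S \ N) ∧ IsPathCoverE (T ∪ N) ∧ (S \ N) ∪ (T ∪ N) = S ∪ T ∧
      (S \ N) ∩ (T ∪ N) = S ∩ T ∧ V1E (S \ N) ∪ V1E (T ∪ N) = Set.univ \ {v2} ∧
      V1E (S \ N) ∩ V1E (T ∪ N) = ∅ ∧ ∀ v, degE N v = 1 → v ∈ V1E (S \ N) := by
  have hd1 : ∀ v, degE (S \ N) v + degE N v = 2 := fun v => (degE_sdiff hNS v).trans (hS.2 v)
  have hd2 : ∀ v, degE (T ∪ N) v = degE T v + degE N v := fun v => degE_union hNT v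
  have hspan : ∀ F : Finset (Sym2 W), (∀ v, 0 < degE F v) → SpanningE F := fun F h =>
    Set.eq_univ_of_forall fun v => degE_pos_iff.1 (h v)
  have hv : ∀ v, v = v2 ∧ degE (S \ N) v = 2 ∧ degE (T ∪ N) v = 2 ∧ degE N v = 0 ∨
      v ≠ v2 ∧ degE (S \ N) v = 2 ∧ degE (T ∪ N) v = 1 ∧ degE N v = 0 ∨
      v ≠ v2 ∧ degE (S \ N) v = 1 ∧ degE (T ∪ N) v = 2 ∧ degE N v = 1 := by
    intro v
    have h1 := hd1 v
    have h2 := hd2 v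
    have h3 := hN v
    by_cases h : v = v2
    · subst h; left; refine ⟨rfl, ?_⟩; omega
    · have := hone v h
      right
      by_cases h0 : degE N v = 0
      · left; refine ⟨h, ?_⟩; omega
      · right; refine ⟨h, ?_⟩; omega
  refine ⟨⟨⟨fun e he => hS.1 e (Finset.sdiff_subset he), fun v => ?_⟩, hspan _ fun v => ?_, ?_⟩,
    ⟨⟨fun e he => ?_, fun v => ?_⟩, hspan _ fun v => ?_, hac⟩, ?_, ?_, ?_, ?_, ?_⟩
  · have := hv v; omega
  · have := hv v; omega
  · intro C hC hcyc
    obtain ⟨e, heN, heC⟩ := hmeet C hcyc (hC.trans Finset.sdiff_subset)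
    exact (Finset.mem_sdiff.1 (hC heC)).2 heN
  · rcases Finset.mem_union.1 he with he | he
    exacts [hT.1 e he, hS.1 e (hNS he)]
  · have := hv v; omega
  · have := hv v; omega
  · ext e
    have : e ∈ N → e ∈ S := fun h => hNS h
    simp only [Finset.mem_union, Finset.mem_sdiff]
    tauto
  · ext e
    have : e ∈ T → e ∉ N := fun h => Finset.disjoint_left.1 hNT h
    simp only [Finset.mem_union, Finset.mem_sdiff, Finset.mem_inter]
    tauto
  · ext v
    have := hv v
    simp only [V1E, Set.mem_union, Set.mem_ofPred_eq, Set.mem_sdiff, Set.mem_univ, true_and,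
      Set.mem_singleton_iff]
    grind
  · ext v
    have := hv v
    simp only [V1E, Set.mem_inter_iff, Set.mem_ofPred_eq, Set.mem_empty_iff_false]
    grind
  · intro v h1
    have := hv v
    simp only [V1E, Set.mem_ofPred_eq]
    omega

/-- Let `T` be a perfect matching away from a cycle `D` of the 2-factor `S`.
A matching that keeps `T` acyclic can be extended to one meeting all cycles other than `D`. -/
lemma exists_matching_meeting_cycles [Finite W] {S T D : Finset (Sym2 W)} {f : Sym2 W}
    (hS : IsKFactor 2 S) (hD : IsCycleE D) (hDS : D ⊆ S)
    (hone : ∀ v, v ∉ VsetE D → degE T v = 1)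
    (hfS : f ∈ S) (hfT : f ∉ T) (hfD : f ∉ D) (hac : AcyclicE (T ∪ {f}))
    (hlab : ∃ c : W → Finset (Sym2 W), IsPathLabel (T ∪ {f}) c) :
    ∃ M : Finset (Sym2 W), f ∈ M ∧ M ⊆ S ∧ Disjoint T M ∧ Disjoint D M ∧ (∀ v, degE M v ≤ 1) ∧
      AcyclicE (T ∪ M) ∧ (∃ c : W → Finset (Sym2 W), IsPathLabel (T ∪ M) c) ∧
      ∀ C, IsCycleE C → C ⊆ S → C ≠ D → ∃ e ∈ M, e ∈ C := by
  let good : Finset (Sym2 W) → Prop := fun M => f ∈ M ∧ M ⊆ S ∧ Disjoint T M ∧ Disjoint D M ∧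
    (∀ v, degE M v ≤ 1) ∧ AcyclicE (T ∪ M) ∧ ∃ c : W → Finset (Sym2 W), IsPathLabel (T ∪ M) c
  have hgood : good {f} := by
    refine ⟨by simp, by simpa, by simpa, by simpa, fun v => ?_, hac, hlab⟩
    exact (Finset.card_le_card (Finset.filter_subset _ _)).trans (by simp)
  obtain ⟨M, -, hM⟩ := (Set.toFinite {M | good M}).exists_le_maximal hgood
  obtain ⟨hfM, hMS, hTM, hDM, hM1, hMac, c, hc⟩ := hM.1
  refine ⟨M, hfM, hMS, hTM, hDM, hM1, hMac, ⟨c, hc⟩, fun C hC hCS hCD => ?_⟩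
  by_contra! hno
  have hS2 : ∀ v, degE S v ≤ 2 := fun v => (hS.2 v).le
  have hCM : ∀ x ∈ VsetE C, degE M x = 0 := fun x hx => degE_eq_zero fun e he hxe =>
    hno e he (hC.mem_of_touch hS2 hCS hx (hMS he) hxe)
  have hCT : ∀ x ∈ VsetE C, degE T x = 1 := fun x hx => hone x fun hxD =>
    hCD (hC.eq_of_touch hS2 hCS hD hDS hx hxD)
  have hCTM : ∀ x ∈ VsetE C, degE (T ∪ M) x = 1 := fun x hx => by
    rw [degE_union hTM, hCM x hx, hCT x hx]
  have hext : ∃ u w, s(u, w) ∈ C ∧ c u ≠ c w := by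
    obtain ⟨⟨u, x⟩, he⟩ := hC.nonempty
    obtain ⟨w, w', hw, hw', hww, h1, h2⟩ :=
      hC.exists_two_neighbors (x := u) ⟨_, he, Sym2.mem_mk_left u x⟩
    have hdeg : ∀ {a b}, s(a, b) ∈ C → degE (T ∪ M) a ≤ 1 ∧ degE (T ∪ M) b ≤ 1 := fun h =>
      ⟨(hCTM _ ⟨_, h, by simp⟩).le, (hCTM _ ⟨_, h, by simp⟩).le⟩
    by_contra! hall
    exact hc.2 w u w' hw hw'.symm hww (hdeg h1).2 (hdeg h1).1 (hdeg h2).2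
      ⟨(hall _ _ h1).symm, hall _ _ h2⟩
  obtain ⟨u, w, huw, hcuw⟩ := hext
  have hu : u ∈ VsetE C := ⟨_, huw, by simp⟩
  have hw : w ∈ VsetE C := ⟨_, huw, by simp⟩
  have hnew : s(u, w) ∉ T ∪ M := fun h => hcuw (hc.1 u w h)
  rw [Finset.mem_union, not_or] at hnew
  have hbig : good (insert s(u, w) M) := by
    refine ⟨by simp [hfM], Finset.insert_subset (hCS huw) hMS,
      Finset.disjoint_insert_right.2 ⟨hnew.1, hTM⟩, Finset.disjoint_insert_right.2 ⟨?_, hDM⟩,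
      fun v => ?_, ?_⟩
    · exact fun h => hCD (hC.eq_of_touch hS2 hCS hD hDS hu ⟨_, h, by simp⟩)
    · rw [degE_insert hnew.2]
      split_ifs with h
      · rw [hCM v ⟨_, huw, h⟩]
      · simpa using hM1 v
    · rw [Finset.union_insert]
      exact ⟨hMac.insert hc.1 hcuw, _, hc.insert hcuw (hCTM u hu) (hCTM w hw)⟩
  exact hnew.2 (hM.2 hbig (Finset.subset_insert _ _) (Finset.mem_insert_self _ _))

lemma maxPathE_pair {F : Finset (Sym2 W)} {v1 v2 v3 : W} (h12 : v1 ≠ v2) (h23 : v2 ≠ v3)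
    (h13 : v1 ≠ v3) (e12 : s(v1, v2) ∈ F) (e23 : s(v2, v3) ∈ F)
    (d1 : degE F v1 ≤ 1) (d2 : degE F v2 ≤ 2) (d3 : degE F v3 ≤ 1) :
    MaxPathE F {s(v1, v2), s(v2, v3)} := by
  refine ⟨?_, ⟨v1, v3, 2, by omega, fun i => if i = 0 then v1 else if i = 1 then v2 else v3,
    ?_, by simp, by simp, ?_⟩, ?_⟩
  · intro e he
    simp only [Finset.mem_insert, Finset.mem_singleton] at he
    rcases he with rfl | rfl <;> assumption
  · intro i hi j hj
    interval_cases i <;> interval_cases j <;> simp <;> grind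
  · simp [Finset.range_add_one, Finset.pair_comm]
  · rintro e he ⟨v, hve, g, hg, hvg⟩
    have hv : v = v1 ∨ v = v2 ∨ v = v3 := by
      simp only [Finset.mem_insert, Finset.mem_singleton] at hg
      rcases hg with rfl | rfl <;> simp at hvg <;> tauto
    simp only [Finset.mem_insert, Finset.mem_singleton]
    rcases hv with rfl | rfl | rfl
    · exact Or.inl (eq_of_degE_le_one d1 he hve e12 (by simp))
    · exact eq_or_eq_of_degE_le_two d2 (by grind) e12 (by simp) e23 (by simp) he hve
    · exact Or.inr (eq_of_degE_le_one d3 he hve e23 (by simp))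

end

/-- Lemma 9 of the paper. -/
theorem stmt7 (S Cstar Cstar2 T : Finset (Sym2 V)) (v0 v1 v2 v3 v4 v5 : V)
    (f : Sym2 V) (q : V)
    (hS : IsKFactor 2 S) (hSnot : ¬ IsTourE S)
    (hdist : v1 ≠ v2 ∧ v1 ≠ v3 ∧ v1 ≠ v4 ∧ v2 ≠ v3 ∧ v2 ≠ v4 ∧ v3 ≠ v4)
    (hCstar : IsCycleE Cstar) (hCstarS : Cstar ⊆ S)
    (hP : ({s(v1, v2), s(v2, v3), s(v3, v4)} : Finset (Sym2 V)) ⊆ Cstar)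
    (hv0 : s(v0, v1) ∈ Cstar) (hv5 : s(v4, v5) ∈ Cstar)
    (hv02 : v0 ≠ v2) (hv53 : v5 ≠ v3)
    (hT : IsPathCoverE T) (hT12 : s(v1, v2) ∈ T) (hT23 : s(v2, v3) ∈ T)
    (hV1T : V1E T = Set.univ \ {v2})
    (hCstar2 : IsCycleE Cstar2) (hCstar2S : Cstar2 ⊆ S) (hne : Cstar2 ≠ Cstar)
    (hf : f ∈ Cstar2) (hfT : f ∉ T) (hq : q ∈ f)
    (hins : IsPathCoverE (insert f T)) :
    ∃ S1 S2 T1 T2 : Finset (Sym2 V),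
      IsPathCoverE S1 ∧ IsPathCoverE S2 ∧ IsPathCoverE T1 ∧ IsPathCoverE T2 ∧
      (S1 ∪ T1 = S ∪ T) ∧ (S1 ∩ T1 = S ∩ T) ∧
      (S2 ∪ T2 = S ∪ T) ∧ (S2 ∩ T2 = S ∩ T) ∧
      (V1E S1 ∪ V1E T1 = Set.univ \ {v2}) ∧ (V1E S1 ∩ V1E T1 = ∅) ∧
      (V1E S2 ∪ V1E T2 = Set.univ \ {v2}) ∧ (V1E S2 ∩ V1E T2 = ∅) ∧
      (T1 \ T2 = {s(v3, v4)}) ∧ (T2 \ T1 = {s(v0, v1)}) ∧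
      MaxPathE (T1 ∩ T2) ({s(v1, v2), s(v2, v3)} : Finset (Sym2 V)) ∧
      q ∈ V1E S1 ∧ q ∈ V1E S2 := by
  obtain ⟨h12, h13, h14, h23, h24, h34⟩ := hdist
  have hS2 : ∀ v, degE S v ≤ 2 := fun v => (hS.2 v).le
  have e12 : s(v1, v2) ∈ Cstar := hP (by simp)
  have e34 : s(v3, v4) ∈ Cstar := hP (by simp)
  have m1 : v1 ∈ VsetE Cstar := ⟨_, e12, by simp⟩
  have m2 : v2 ∈ VsetE Cstar := ⟨_, e12, by simp⟩
  have m3 : v3 ∈ VsetE Cstar := ⟨_, e34, by simp⟩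
  have hone : ∀ v, v ≠ v2 → degE T v = 1 := fun v hv => by
    have : v ∈ V1E T := by rw [hV1T]; simpa using hv
    exact this
  have hT2 : degE T v2 = 2 := by
    refine le_antisymm (hT.1.2 v2) ?_
    by_contra hlt
    have := eq_of_degE_le_one (v := v2) (by omega) hT12 (by simp) hT23 (by simp)
    grind
  have h01 : v0 ≠ v1 := fun h => hS.1 _ (hCstarS hv0) (by simp [h])
  have h03 : v0 ≠ v3 := by
    rintro rfl
    have := eq_or_eq_of_degE_le_two (hS2 v0) (a := s(v2, v0)) (b := s(v0, v4)) (e := s(v0, v1))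
      (by grind) (hCstarS (hP (by simp))) (by simp) (hCstarS e34) (by simp) (hCstarS hv0) (by simp)
    grind
  have n34 : s(v3, v4) ∉ T := fun h => by
    have := eq_of_degE_le_one (hone v3 h23.symm).le h (by simp) hT23 (by simp)
    grind
  have n01 : s(v0, v1) ∉ T := fun h => by
    have := eq_of_degE_le_one (hone v1 h12).le h (by simp) hT12 (by simp)
    grind
  have hfstar : ∀ x ∈ f, x ∉ VsetE Cstar := fun x hx hxC =>
    hne (hCstar2.eq_of_touch hS2 hCstar2S hCstar hCstarS ⟨f, hf, hx⟩ hxC)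
  have hTf : T ∪ {f} = insert f T := by rw [Finset.union_comm, ← Finset.insert_eq]
  have hlab : ∃ c : V → Finset (Sym2 V), IsPathLabel (T ∪ {f}) c := by
    obtain ⟨c, hc, hsep⟩ := exists_isPathLabel hT.1 h13 h12 h23.symm hT12 hT23 hone
    rw [hTf]
    obtain ⟨a, b⟩ := f
    have ha := hfstar a (Sym2.mem_mk_left a b)
    have hb := hfstar b (Sym2.mem_mk_right a b)
    have hav : ∀ w ∈ VsetE Cstar, a ≠ w := by rintro w hw rfl; exact ha hw
    have hbv : ∀ w ∈ VsetE Cstar, b ≠ w := by rintro w hw rfl; exact hb hw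
    have hab : a ≠ b := fun h => hS.1 _ (hCstar2S hf) (Sym2.mk_isDiag_iff.2 h)
    exact ⟨_, hc.insert (hsep a b hab hfT (hav _ m1) (hav _ m2) (hav _ m3) (hbv _ m1) (hbv _ m2)
      (hbv _ m3)) (hone a (hav _ m2)) (hone b (hbv _ m2))⟩
  have hfC : f ∉ Cstar := fun h => hfstar q hq ⟨f, h, hq⟩
  obtain ⟨M, hfM, hMS, hTM, hCM, hM1, hMac, ⟨c, hc⟩, hmeet⟩ :=
    exists_matching_meeting_cycles hS hCstar hCstarS
      (fun v hv => hone v (by rintro rfl; exact hv m2)) (hCstar2S hf) hfT hfC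
      (hTf ▸ hins.2.2) hlab
  have hM0 : ∀ x ∈ VsetE Cstar, degE M x = 0 := fun x hx => degE_eq_zero fun e he hxe =>
    Finset.disjoint_left.1 hCM (hCstar.mem_of_touch hS2 hCstarS hx (hMS he) hxe) he
  have hTMone : ∀ x ∈ VsetE Cstar, x ≠ v2 → degE (T ∪ M) x ≤ 1 := fun x hx hx2 => by
    rw [degE_union hTM, hM0 x hx, hone x hx2]
  have hc13 : c v1 = c v3 := (hc.1 _ _ (Finset.mem_union_left _ hT12)).trans
    (hc.1 _ _ (Finset.mem_union_left _ hT23))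
  have hcsep : ∀ x ∈ VsetE Cstar, x ≠ v1 → x ≠ v2 → x ≠ v3 → c v3 ≠ c x := fun x hx x1 x2 x3 h =>
    hc.2 v1 v3 x h13 x3.symm x1.symm (hTMone _ m1 h12) (hTMone _ m3 h23.symm) (hTMone _ hx x2)
      ⟨hc13, h⟩
  have hexch : ∀ a b, s(a, b) ∈ Cstar → a ≠ v2 → b ≠ v2 → s(a, b) ∉ T → c a ≠ c b → _ :=
    fun a b hab ha2 hb2 habT hcab => isPathCoverE_exchange (N := insert s(a, b) M) hS hT.1 hT2 hone
      (Finset.insert_subset (hCstarS hab) hMS) (Finset.disjoint_insert_right.2 ⟨habT, hTM⟩)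
      (fun v => by
        rw [degE_insert (Finset.disjoint_left.1 hCM hab)]
        split_ifs with h
        · rw [hM0 v ⟨_, hab, h⟩]
        · simpa using hM1 v)
      (by
        rw [degE_insert (Finset.disjoint_left.1 hCM hab), hM0 v2 m2, if_neg]
        simp [ha2.symm, hb2.symm])
      (fun C hC hCS => by
        by_cases h : C = Cstar
        · exact ⟨_, Finset.mem_insert_self _ _, h ▸ hab⟩
        · obtain ⟨e, heM, heC⟩ := hmeet C hC hCS h
          exact ⟨e, Finset.mem_insert_of_mem heM, heC⟩)
      (by rw [Finset.union_insert]; exact hMac.insert hc.1 hcab)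
  have hq1 : ∀ e ∈ Cstar, degE (insert e M) q = 1 := fun e he => by
    rw [degE_insert (Finset.disjoint_left.1 hCM he), if_neg fun h => hfstar q hq ⟨e, he, h⟩]
    exact le_antisymm (hM1 q) (degE_pos_iff.2 ⟨f, hfM, hq⟩)
  obtain ⟨cS1, cT1, u1, i1, p1, d1, q1⟩ := hexch v3 v4 e34 h23.symm h24.symm n34
    (hcsep v4 ⟨_, e34, by simp⟩ h14.symm h24.symm h34.symm)
  obtain ⟨cS2, cT2, u2, i2, p2, d2, q2⟩ := hexch v0 v1 hv0 hv02 h12 n01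
    (fun h => hcsep v0 ⟨_, hv0, by simp⟩ h01 hv02 h03 (hc13.symm.trans h.symm))
  have k34 : s(v3, v4) ∉ T ∪ M := by
    simpa [n34] using Finset.disjoint_left.1 hCM e34
  have k01 : s(v0, v1) ∉ T ∪ M := by
    simpa [n01] using Finset.disjoint_left.1 hCM hv0
  have hdiff : s(v3, v4) ≠ s(v0, v1) := by grind
  refine ⟨_, _, _, _, cS1, cS2, cT1, cT2, u1, i1, u2, i2, p1, d1, p2, d2, ?_, ?_, ?_,
    q1 q (hq1 _ e34), q2 q (hq1 _ hv0)⟩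
  · simp only [Finset.union_insert]
    ext e
    simp only [Finset.mem_sdiff, Finset.mem_insert, Finset.mem_singleton]
    grind
  · simp only [Finset.union_insert]
    ext e
    simp only [Finset.mem_sdiff, Finset.mem_insert, Finset.mem_singleton]
    grind
  · have hT12' : (T ∪ insert s(v3, v4) M) ∩ (T ∪ insert s(v0, v1) M) = T ∪ M := by
      simp only [Finset.union_insert]
      ext e
      simp only [Finset.mem_inter, Finset.mem_insert]
      grind
    rw [hT12']
    exact maxPathE_pair h12 h23 h13 (Finset.mem_union_left _ hT12) (Finset.mem_union_left _ hT23)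
      (hTMone _ m1 h12) (by rw [degE_union hTM, hM0 v2 m2, hT2]) (hTMone _ m3 h23.symm)
end

section
/- Let S′1 and S′2 be path covers of G with 𝒫(S′1) = {Q′1, …, Q′k, P′1} and 𝒫(S′2) = {Q′1, …, Q′k, P′2}, where k ≥ 1, each Q′_i is an (x′_i, y′_i)-path (the Q′_i are common to both path covers and pairwise vertex-disjoint), P′1 is a (v1, v2)-path, P′2 is a (v4, v5)-path, V(P′1) = V(P′2), v2 ∉ {v4, v5} and v4 ∉ {v1, v2} (the case v5 = v1 is allowed). Then there exist edge sets A′1, A′2 ⊆ E with A′1 ∩ A′2 = ∅ such that: (i) S′_i ∪ A′_i is a tour of G for i = 1,2; (ii) V(A′_i) = V1(S′_i) for i = 1,2; and (iii) A′1 ∪ A′2 consists of a (v2, v4)-path if v5 = v1, of vertex-disjoint (v1, v4)- and (v2, v5)-paths if v5 ≠ v1 and k is odd, and of vertex-disjoint (v1, v2)- and (v4, v5)-paths if v5 ≠ v1 and k is even. Moreover, for any prescribed labeling (x′1, y′1) of the two endpoints of Q′1, the sets A′1 and A′2 can be chosen so that (v2, x′1) ∈ A′1 and (v4, y′1) ∈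 A′2. -/
variable {V : Type*} [Fintype V] [DecidableEq V]

set_option linter.unusedSectionVars false

open Finset in
theorem mem_VsetE_image {m : ℕ} (hm : 1 ≤ m) (f : ℕ → V) (v : V) :
    v ∈ VsetE ((range m).image (fun i => s(f i, f (i + 1)))) ↔ ∃ i ≤ m, v = f i := by
  simp only [VsetE, Set.mem_ofPred_eq, mem_image, mem_range]
  constructor
  · rintro ⟨e, ⟨i, hi, rfl⟩, hv⟩
    rcases Sym2.mem_iff.1 hv with h | h
    · exact ⟨i, by omega, h⟩
    · exact ⟨i + 1, by omega, h⟩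
  · rintro ⟨i, hi, rfl⟩
    rcases Nat.lt_or_ge i m with h | h
    · exact ⟨_, ⟨i, h, rfl⟩, Sym2.mem_mk_left _ _⟩
    · refine ⟨_, ⟨m - 1, by omega, rfl⟩, ?_⟩
      have : i = m - 1 + 1 := by omega
      rw [this]
      exact Sym2.mem_mk_right _ _

theorem VsetE_union (F F' : Finset (Sym2 V)) : VsetE (F ∪ F') = VsetE F ∪ VsetE F' := by
  ext v
  simp only [VsetE, Finset.mem_union, Set.mem_ofPred_eq, Set.mem_union]
  grind

theorem VsetE_singleton (a b : V) : VsetE {s(a, b)} = ({a, b} : Set V) := by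
  ext v
  simp [VsetE]

open Finset in
theorem IsPathE.symm {F : Finset (Sym2 V)} {a b : V} (h : IsPathE F a b) : IsPathE F b a := by
  obtain ⟨m, hm, f, hf, rfl, rfl, rfl⟩ := h
  refine ⟨m, hm, fun i => f (m - i), ?_, by simp, by simp, ?_⟩
  · intro i hi j hj h
    have := hf _ (by omega) _ (by omega) h
    omega
  · ext e
    simp only [mem_image, mem_range]
    constructor
    · rintro ⟨i, hi, rfl⟩
      refine ⟨m - 1 - i, by omega, ?_⟩
      rw [show m - (m - 1 - i) = i + 1 by omega, show m - (m - 1 - i + 1) = i by omega]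
      exact Sym2.eq_swap
    · rintro ⟨i, hi, rfl⟩
      refine ⟨m - 1 - i, by omega, ?_⟩
      rw [show m - i = (m - 1 - i) + 1 by omega, show m - (i + 1) = m - 1 - i by omega]
      exact Sym2.eq_swap

theorem IsPathE.left_mem {F : Finset (Sym2 V)} {a b : V} (h : IsPathE F a b) : a ∈ VsetE F := by
  obtain ⟨m, hm, f, hf, rfl, rfl, rfl⟩ := h
  exact (mem_VsetE_image hm f _).2 ⟨0, by omega, rfl⟩

theorem IsPathE.right_mem {F : Finset (Sym2 V)} {a b : V} (h : IsPathE F a b) : b ∈ VsetE F :=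
  h.symm.left_mem

theorem IsPathE.ne {F : Finset (Sym2 V)} {a b : V} (h : IsPathE F a b) : a ≠ b := by
  obtain ⟨m, hm, f, hf, rfl, rfl, rfl⟩ := h
  intro h
  have := hf _ (by omega) _ le_rfl h
  omega

open Finset in
theorem isPathE_singleton {a b : V} (h : a ≠ b) : IsPathE {s(a, b)} a b := by
  refine ⟨1, le_rfl, fun i => if i = 0 then a else b, ?_, by simp, by simp, by simp⟩
  intro i hi j hj hij
  grind

open Finset in
/-- Two paths that meet only in a common endpoint concatenate to a path. -/
theorem IsPathE.trans {F F' : Finset (Sym2 V)} {a b c : V} (h : IsPathE F a b)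
    (h' : IsPathE F' b c) (hd : ∀ v ∈ VsetE F, v ∈ VsetE F' → v = b) :
    IsPathE (F ∪ F') a c := by
  obtain ⟨m, hm, f, hf, rfl, rfl, rfl⟩ := h
  obtain ⟨n, hn, g, hg, hg0, rfl, rfl⟩ := h'
  have key : ∀ i ≤ m, ∀ j ≤ n, f i = g j → i = m ∧ j = 0 := by
    intro i hi j hj h
    have h1 := hd (f i) ((mem_VsetE_image hm f _).2 ⟨i, hi, rfl⟩)
      ((mem_VsetE_image hn g _).2 ⟨j, hj, h⟩)
    exact ⟨hf _ hi _ le_rfl h1, hg _ hj _ (by omega) (by rw [hg0, ← h1, h])⟩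
  refine ⟨m + n, by omega, fun i => if i ≤ m then f i else g (i - m), ?_, by simp, ?_, ?_⟩
  · intro i hi j hj hij
    simp only at hij
    split_ifs at hij with h1 h2 h2
    · exact hf _ h1 _ h2 hij
    · have := key _ h1 _ (by omega) hij
      omega
    · have := key _ h2 _ (by omega) hij.symm
      omega
    · have := hg _ (by omega) _ (by omega) hij
      omega
  · simp only
    rw [if_neg (by omega)]
    simp
  · ext e
    simp only [mem_union, mem_image, mem_range]
    constructor
    · rintro (⟨i, hi, rfl⟩ | ⟨i, hi, rfl⟩)
      · exact ⟨i, by omega, by rw [if_pos (by omega), if_pos (by omega)]⟩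
      · refine ⟨m + i, by omega, ?_⟩
        rw [if_neg (by omega : ¬ m + i + 1 ≤ m), show m + i + 1 - m = i + 1 by omega]
        rcases Nat.eq_zero_or_pos i with rfl | h
        · simp [hg0]
        · rw [if_neg (by omega), show m + i - m = i by omega]
    · rintro ⟨i, hi, rfl⟩
      rcases Nat.lt_or_ge i m with h | h
      · exact Or.inl ⟨i, h, by rw [if_pos (by omega), if_pos (by omega)]⟩
      · refine Or.inr ⟨i - m, by omega, ?_⟩
        rw [if_neg (by omega : ¬ i + 1 ≤ m), show i + 1 - m = i - m + 1 by omega]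
        rcases Nat.eq_or_lt_of_le h with rfl | h
        · simp [hg0]
        · rw [if_neg (by omega)]

open Finset in
/-- Joining the endpoints of a path with at least two edges gives a cycle. -/
theorem IsPathE.isCycleE {F : Finset (Sym2 V)} {a b : V} (h : IsPathE F a b)
    (hF : F ≠ {s(a, b)}) : IsCycleE (F ∪ {s(b, a)}) := by
  obtain ⟨m, hm, f, hf, rfl, rfl, rfl⟩ := h
  have hm2 : 2 ≤ m := by
    by_contra hlt
    obtain rfl : m = 1 := by omega
    exact hF (by simp)
  refine ⟨m + 1, by omega, f, fun i hi j hj => hf i (by omega) j (by omega), ?_⟩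
  rw [range_add_one, image_insert, Nat.mod_self, union_comm, ← insert_eq]
  congr 1
  apply image_congr
  intro i hi
  have : i < m := by simpa using hi
  simp only
  rw [Nat.mod_eq_of_lt (by omega)]

open Finset in
/-- The vertices of degree one in a path are its two endpoints. -/
theorem IsPathE.degE_eq_one_iff {F : Finset (Sym2 V)} {a b : V} (h : IsPathE F a b) {v : V}
    (hv : v ∈ VsetE F) : degE F v = 1 ↔ v = a ∨ v = b := by
  have hend : ∀ {a b : V}, IsPathE F a b → degE F a = 1 := by
    rintro a b ⟨m, hm, f, hf, rfl, rfl, rfl⟩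
    rw [degE, card_eq_one]
    refine ⟨s(f 0, f 1), ?_⟩
    ext e
    simp only [mem_filter, mem_image, mem_range, mem_singleton]
    constructor
    · rintro ⟨⟨i, hi, rfl⟩, hv⟩
      rcases Sym2.mem_iff.1 hv with h | h
      · rw [← hf _ (by omega) _ (by omega) h]
      · have := hf _ (by omega) _ (by omega) h
        omega
    · rintro rfl
      exact ⟨⟨0, by omega, rfl⟩, Sym2.mem_mk_left _ _⟩
  refine ⟨?_, by rintro (rfl | rfl); exacts [hend h, hend h.symm]⟩
  obtain ⟨m, hm, f, hf, rfl, rfl, rfl⟩ := h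
  obtain ⟨i, hi, rfl⟩ := (mem_VsetE_image hm f _).1 hv
  intro h1
  by_contra hne
  have h0 : i ≠ 0 := by rintro rfl; simp at hne
  have hm' : i ≠ m := by rintro rfl; simp at hne
  rw [degE, card_eq_one] at h1
  obtain ⟨e, he⟩ := h1
  have e1 : s(f (i - 1), f (i - 1 + 1)) = e := by
    rw [← mem_singleton, ← he, mem_filter, mem_image]
    refine ⟨⟨i - 1, mem_range.2 (by omega), rfl⟩, ?_⟩
    rw [show i - 1 + 1 = i by omega]
    exact Sym2.mem_mk_right _ _
  have e2 : s(f i, f (i + 1)) = e := by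
    rw [← mem_singleton, ← he, mem_filter, mem_image]
    exact ⟨⟨i, mem_range.2 (by omega), rfl⟩, Sym2.mem_mk_left _ _⟩
  have : f (i + 1) ∈ s(f (i - 1), f (i - 1 + 1)) := by
    rw [e1, ← e2]
    exact Sym2.mem_mk_right _ _
  rcases Sym2.mem_iff.1 this with h | h
  · have := hf _ (by omega) _ (by omega) h
    omega
  · have := hf _ (by omega) _ (by omega) h
    omega

theorem MaxPathE.degE_eq {F P : Finset (Sym2 V)} (h : MaxPathE F P) {v : V}
    (hv : v ∈ VsetE P) : degE F v = degE P v := by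
  unfold degE
  congr 1
  ext e
  simp only [Finset.mem_filter]
  exact ⟨fun he => ⟨h.2.2 e he.1 ⟨v, he.2, hv⟩, he.2⟩, fun he => ⟨h.1 he.1, he.2⟩⟩

open Finset in
theorem MaxPathE.subset_of_mem {F P R : Finset (Sym2 V)} (hP : MaxPathE F P)
    (hR : MaxPathE F R) {v : V} (hvP : v ∈ VsetE P) (hvR : v ∈ VsetE R) : P ⊆ R := by
  obtain ⟨hPF, ⟨a, b, m, hm, f, hf, rfl, rfl, rfl⟩, -⟩ := hP
  have step : ∀ i < m, s(f i, f (i + 1)) ∈ R ∨ (f i ∉ VsetE R ∧ f (i + 1) ∉ VsetE R) := by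
    intro i hi
    have hF := hPF (mem_image.2 ⟨i, mem_range.2 hi, rfl⟩)
    by_cases h1 : f i ∈ VsetE R
    · exact Or.inl (hR.2.2 _ hF ⟨f i, Sym2.mem_mk_left _ _, h1⟩)
    by_cases h2 : f (i + 1) ∈ VsetE R
    · exact Or.inl (hR.2.2 _ hF ⟨f (i + 1), Sym2.mem_mk_right _ _, h2⟩)
    exact Or.inr ⟨h1, h2⟩
  have hiff : ∀ i ≤ m, (f i ∈ VsetE R ↔ f 0 ∈ VsetE R) := by
    intro i
    induction i with
    | zero => simp
    | succ i ih =>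
      intro hi
      rw [← ih (by omega)]
      rcases step i (by omega) with h | h
      · exact ⟨fun _ => ⟨_, h, Sym2.mem_mk_left _ _⟩, fun _ => ⟨_, h, Sym2.mem_mk_right _ _⟩⟩
      · exact ⟨fun h' => absurd h' h.2, fun h' => absurd h' h.1⟩
  obtain ⟨j, hj, rfl⟩ := (mem_VsetE_image hm f _).1 hvP
  intro e he
  obtain ⟨i, hi, rfl⟩ := mem_image.1 he
  rw [mem_range] at hi
  rcases step i hi with h | h
  · exact h
  · exact absurd ((hiff i hi.le).2 ((hiff j hj).1 hvR)) h.1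

theorem MaxPathE.eq_of_mem {F P R : Finset (Sym2 V)} (hP : MaxPathE F P)
    (hR : MaxPathE F R) {v : V} (hvP : v ∈ VsetE P) (hvR : v ∈ VsetE R) : P = R :=
  (hP.subset_of_mem hR hvP hvR).antisymm (hR.subset_of_mem hP hvR hvP)

open Finset in
/-- In a 2-matching, an edge outside a path can only touch the path at an endpoint. -/
theorem IsPathE.eq_or_eq_of_notMem {F P : Finset (Sym2 V)} {a b v : V} (hF : IsKMatching 2 F)
    (hP : IsPathE P a b) (hPF : P ⊆ F) {e : Sym2 V} (he : e ∈ F) (heP : e ∉ P)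
    (hve : v ∈ e) (hv : v ∈ VsetE P) : v = a ∨ v = b := by
  rw [← hP.degE_eq_one_iff hv]
  have hpos : 0 < degE P v := by
    obtain ⟨e', he', hve'⟩ := hv
    exact card_pos.2 ⟨e', mem_filter.2 ⟨he', hve'⟩⟩
  have hlt : degE P v < degE F v := by
    apply card_lt_card
    rw [ssubset_iff_of_subset (filter_subset_filter _ hPF)]
    exact ⟨e, mem_filter.2 ⟨he, hve⟩, fun h => heP (mem_filter.1 h).1⟩
  have := hF.2 v
  omega

open Finset in
theorem exists_maxPathE {F : Finset (Sym2 V)} (hF : IsPathCoverE F) {e : Sym2 V} (he : e ∈ F) :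
    ∃ P, MaxPathE F P ∧ e ∈ P := by
  classical
  set T := F.powerset.filter (fun P => e ∈ P ∧ ∃ a b, IsPathE P a b) with hT
  have hne : T.Nonempty := by
    refine ⟨{e}, ?_⟩
    simp only [hT, mem_filter, mem_powerset, singleton_subset_iff, mem_singleton, true_and]
    refine ⟨he, ?_⟩
    induction e with
    | _ u w =>
      exact ⟨u, w, isPathE_singleton fun h => hF.1.1 _ he (by simpa using h)⟩
  obtain ⟨P, hPT, hmax⟩ := T.exists_max_image card hne
  simp only [hT, mem_filter, mem_powerset] at hPT hmax
  obtain ⟨hPF, heP, a, b, hP⟩ := hPT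
  refine ⟨P, ⟨hPF, ⟨a, b, hP⟩, ?_⟩, heP⟩
  rintro e' he' ⟨v, hve, hv⟩
  by_contra hn
  have main : ∀ {a b : V}, IsPathE P a b → b ∉ e' := by
    intro a b hP hb
    obtain ⟨w, rfl⟩ := hb
    have hbw : b ≠ w := fun h => hF.1.1 _ he' (by simpa using h)
    by_cases hw : w ∈ VsetE P
    · rcases hP.eq_or_eq_of_notMem hF.1 hPF he' hn (Sym2.mem_mk_right _ _) hw with rfl | h
      · refine hF.2.2 (P ∪ {s(b, w)}) (union_subset hPF (singleton_subset_iff.2 he'))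
          (hP.isCycleE fun h => hn ?_)
        rw [h, Sym2.eq_swap]
        exact mem_singleton_self _
      · exact hbw h.symm
    · have hP' : IsPathE (P ∪ {s(b, w)}) a w := by
        refine hP.trans (isPathE_singleton hbw) fun u hu hu' => ?_
        rw [VsetE_singleton] at hu'
        rcases hu' with h | h
        · exact h
        · exact absurd (h ▸ hu) hw
      have := hmax _ ⟨union_subset hPF (singleton_subset_iff.2 he'),
        mem_union_left _ heP, a, w, hP'⟩
      rw [card_union_of_disjoint (by simpa using hn)] at this
      simp at this
  rcases hP.eq_or_eq_of_notMem hF.1 hPF he' hn hve hv with rfl | rfl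
  · exact main hP.symm hve
  · exact main hP hve

/-- The edges that link an `(a, b)`-path and the `(x i, y i)`-paths, `i < k`, to a cycle. -/
def linkE (a b : V) (x y : ℕ → V) (k : ℕ) : Finset (Sym2 V) :=
  (Finset.range (k + 1)).image
    (fun i => s(if i = 0 then b else y (i - 1), if i = k then a else x i))

theorem VsetE_linkE (a b : V) (x y : ℕ → V) (k : ℕ) (v : V) :
    v ∈ VsetE (linkE a b x y k) ↔ (v = a ∨ v = b) ∨ ∃ i < k, v = x i ∨ v = y i := by
  simp only [VsetE, linkE, Set.mem_ofPred_eq, Finset.mem_image, Finset.mem_range]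
  constructor
  · rintro ⟨e, ⟨i, hi, rfl⟩, hv⟩
    rcases Sym2.mem_iff.1 hv with h | h <;> split_ifs at h with h'
    · exact Or.inl (Or.inr h)
    · exact Or.inr ⟨i - 1, by omega, Or.inr h⟩
    · exact Or.inl (Or.inl h)
    · exact Or.inr ⟨i, by omega, Or.inl h⟩
  · rintro ((rfl | rfl) | ⟨i, hi, rfl | rfl⟩)
    · exact ⟨_, ⟨k, by omega, rfl⟩, by simp⟩
    · exact ⟨_, ⟨0, by omega, rfl⟩, by simp⟩
    · exact ⟨_, ⟨i, by omega, rfl⟩, by simp [hi.ne]⟩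
    · exact ⟨_, ⟨i + 1, by omega, rfl⟩, by simp⟩

open Finset in
theorem isCycleE_linkE {P : Finset (Sym2 V)} {Q : ℕ → Finset (Sym2 V)} {a b : V} {x y : ℕ → V}
    {k : ℕ} (hk : 1 ≤ k) (hP : IsPathE P a b) (hQ : ∀ i < k, IsPathE (Q i) (x i) (y i))
    (hQd : ∀ i < k, ∀ j < k, i ≠ j → Disjoint (VsetE (Q i)) (VsetE (Q j)))
    (hPQ : ∀ i < k, Disjoint (VsetE P) (VsetE (Q i))) :
    IsCycleE ((P ∪ (range k).biUnion Q) ∪ linkE a b x y k) := by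
  have key : ∀ j ≤ k,
      IsPathE (P ∪ (range j).biUnion Q ∪
        (range j).image (fun i => s(if i = 0 then b else y (i - 1), x i)))
        a (if j = 0 then b else y (j - 1)) ∧
      ∀ v ∈ VsetE (P ∪ (range j).biUnion Q ∪
        (range j).image (fun i => s(if i = 0 then b else y (i - 1), x i))),
        v ∈ VsetE P ∨ ∃ i < j, v ∈ VsetE (Q i) := by
    intro j
    induction j with
    | zero => simpa using hP
    | succ j ih =>
      intro hj
      obtain ⟨ih1, ih2⟩ := ih (by omega)
      set F := P ∪ (range j).biUnion Q ∪
        (range j).image (fun i => s(if i = 0 then b else y (i - 1), x i)) with hF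
      set c := if j = 0 then b else y (j - 1) with hc
      have heq : P ∪ (range (j + 1)).biUnion Q ∪
          (range (j + 1)).image (fun i => s(if i = 0 then b else y (i - 1), x i)) =
          F ∪ {s(c, x j)} ∪ Q j := by
        rw [range_add_one, biUnion_insert, image_insert, hF, hc]
        ext e
        simp only [mem_union, mem_insert, mem_singleton]
        tauto
      have hFd : ∀ v ∈ VsetE F, v ∉ VsetE (Q j) := by
        intro v hv hv'
        rcases ih2 v hv with h | ⟨i, hi, h⟩
        · exact Set.disjoint_left.1 (hPQ j (by omega)) h hv'
        · exact Set.disjoint_left.1 (hQd i (by omega) j (by omega) hi.ne) h hv'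
      have hxj := (hQ j (by omega)).left_mem
      have hcF := ih1.right_mem
      rw [heq]
      refine ⟨?_, ?_⟩
      · rw [if_neg (by omega), Nat.add_sub_cancel]
        refine (ih1.trans (isPathE_singleton (b := x j) ?_) ?_).trans (hQ j (by omega)) ?_
        · intro h
          exact hFd c hcF (h ▸ hxj)
        · intro v hv hv'
          rw [VsetE_singleton] at hv'
          rcases hv' with h | h
          · exact h
          · exact absurd hxj (hFd _ (h ▸ hv))
        · intro v hv hv'
          rw [VsetE_union, VsetE_singleton] at hv
          rcases hv with h | h | h
          · exact absurd hv' (hFd _ h)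
          · exact absurd hv' (hFd _ (h ▸ hcF))
          · exact h
      · intro v hv
        rw [VsetE_union, VsetE_union, VsetE_singleton] at hv
        have hF' : v ∈ VsetE F → v ∈ VsetE P ∨ ∃ i < j + 1, v ∈ VsetE (Q i) := fun h =>
          (ih2 v h).imp_right fun ⟨i, hi, h⟩ => ⟨i, by omega, h⟩
        rcases hv with (h | h | h) | h
        · exact hF' h
        · exact hF' (h ▸ hcF)
        · exact Or.inr ⟨j, by omega, h ▸ hxj⟩
        · exact Or.inr ⟨j, by omega, h⟩
  obtain ⟨h1, -⟩ := key k le_rfl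
  have hcyc := h1.isCycleE ?_
  · convert hcyc using 1
    rw [linkE, range_add_one, image_insert]
    have : (range k).image (fun i => s(if i = 0 then b else y (i - 1), if i = k then a else x i)) =
        (range k).image (fun i => s(if i = 0 then b else y (i - 1), x i)) := by
      apply image_congr
      intro i hi
      have : i < k := by simpa using hi
      simp [this.ne]
    rw [this]
    ext e
    simp only [mem_union, mem_insert, mem_singleton, if_true]
    tauto
  · intro h
    have hb : b ∈ VsetE (P ∪ (range k).biUnion Q ∪
        (range k).image (fun i => s(if i = 0 then b else y (i - 1), x i))) := by
      rw [VsetE_union, VsetE_union]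
      exact Or.inl (Or.inl hP.right_mem)
    rw [h, VsetE_singleton, if_neg (by omega)] at hb
    rcases hb with hb | hb
    · exact hP.ne hb.symm
    · exact Set.disjoint_left.1 (hPQ (k - 1) (by omega)) hP.right_mem
        (by rw [hb]; exact (hQ (k - 1) (by omega)).right_mem)

open Finset in
theorem IsPathCoverE.eq_union {S P : Finset (Sym2 V)} {Q : ℕ → Finset (Sym2 V)} {k : ℕ}
    (hS : IsPathCoverE S) (hPS : ∀ R, MaxPathE S R ↔ (R = P ∨ ∃ i < k, R = Q i)) :
    S = P ∪ (range k).biUnion Q := by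
  ext e
  simp only [mem_union, mem_biUnion, mem_range]
  constructor
  · intro he
    obtain ⟨R, hR, heR⟩ := exists_maxPathE hS he
    rcases (hPS R).1 hR with rfl | ⟨i, hi, rfl⟩
    · exact Or.inl heR
    · exact Or.inr ⟨i, hi, heR⟩
  · rintro (h | ⟨i, hi, h⟩)
    · exact ((hPS P).2 (Or.inl rfl)).1 h
    · exact ((hPS (Q i)).2 (Or.inr ⟨i, hi, rfl⟩)).1 h

/-- The linking edges complete a path cover to a tour and cover exactly its path endpoints. -/
theorem IsPathCoverE.linkE_spec {S P : Finset (Sym2 V)} {Q : ℕ → Finset (Sym2 V)} {a b : V}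
    {x y : ℕ → V} {k : ℕ} (hS : IsPathCoverE S)
    (hPS : ∀ R, MaxPathE S R ↔ (R = P ∨ ∃ i < k, R = Q i)) (hk : 1 ≤ k) (hP : IsPathE P a b)
    (hQ : ∀ i < k, IsPathE (Q i) (x i) (y i))
    (hQd : ∀ i < k, ∀ j < k, i ≠ j → Disjoint (VsetE (Q i)) (VsetE (Q j)))
    (hPQ : ∀ i < k, Disjoint (VsetE P) (VsetE (Q i))) :
    IsTourE (S ∪ linkE a b x y k) ∧ VsetE (linkE a b x y k) = V1E S := by
  have hSe := hS.eq_union hPS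
  have hMP : MaxPathE S P := (hPS P).2 (Or.inl rfl)
  have hMQ : ∀ i < k, MaxPathE S (Q i) := fun i hi => (hPS (Q i)).2 (Or.inr ⟨i, hi, rfl⟩)
  refine ⟨⟨?_, ?_⟩, ?_⟩
  · rw [hSe]
    exact isCycleE_linkE hk hP hQ hQd hPQ
  · rw [SpanningE, VsetE_union, hS.2.1, Set.univ_union]
  · ext v
    rw [VsetE_linkE]
    constructor
    · rintro (h | ⟨i, hi, h⟩)
      · have hv : v ∈ VsetE P := by
          rcases h with rfl | rfl
          exacts [hP.left_mem, hP.right_mem]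
        exact (hMP.degE_eq hv).trans ((hP.degE_eq_one_iff hv).2 h)
      · have hv : v ∈ VsetE (Q i) := by
          rcases h with rfl | rfl
          exacts [(hQ i hi).left_mem, (hQ i hi).right_mem]
        exact ((hMQ i hi).degE_eq hv).trans (((hQ i hi).degE_eq_one_iff hv).2 h)
    · intro h1
      have h1 : degE S v = 1 := h1
      have hv : v ∈ VsetE S := by rw [hS.2.1]; trivial
      obtain ⟨e, he, hve⟩ := hv
      obtain ⟨R, hR, heR⟩ := exists_maxPathE hS he
      have hvR : v ∈ VsetE R := ⟨e, heR, hve⟩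
      rw [hR.degE_eq hvR] at h1
      rcases (hPS R).1 hR with rfl | ⟨i, hi, rfl⟩
      · exact Or.inl ((hP.degE_eq_one_iff hvR).1 h1)
      · exact Or.inr ⟨i, hi, ((hQ i hi).degE_eq_one_iff hvR).1 h1⟩

/-- The vertex sequence `a, x 0, y 1, x 2, …, b` with `k` inner vertices. -/
def zigzag (a b : V) (x y : ℕ → V) (k i : ℕ) : V :=
  if i = 0 then a else if i = k + 1 then b else if Even i then y (i - 1) else x (i - 1)

/-- The edges between consecutive vertices of `zigzag`. -/
def zigzagE (a b : V) (x y : ℕ → V) (k : ℕ) : Finset (Sym2 V) :=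
  (Finset.range (k + 1)).image (fun i => s(zigzag a b x y k i, zigzag a b x y k (i + 1)))

theorem isPathE_zigzagE {a b : V} {x y : ℕ → V} {k : ℕ} (hab : a ≠ b)
    (hx : ∀ i < k, ∀ j < k, x i = x j → i = j) (hy : ∀ i < k, ∀ j < k, y i = y j → i = j)
    (hxy : ∀ i < k, ∀ j < k, x i ≠ y j)
    (ha : ∀ i < k, a ≠ x i ∧ a ≠ y i) (hb : ∀ i < k, b ≠ x i ∧ b ≠ y i) :
    IsPathE (zigzagE a b x y k) a b := by
  refine ⟨k + 1, by omega, zigzag a b x y k, ?_, by simp [zigzag], by simp [zigzag], rfl⟩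
  intro i hi j hj h
  unfold zigzag at h
  have hx' := hx (i - 1)
  have hy' := hy (i - 1)
  have hxy' := hxy (i - 1)
  have hxy'' := hxy (j - 1)
  have ha' := ha (i - 1)
  have ha'' := ha (j - 1)
  have hb' := hb (i - 1)
  have hb'' := hb (j - 1)
  grind

theorem mem_VsetE_zigzagE {a b : V} {x y : ℕ → V} {k : ℕ} {v : V}
    (hv : v ∈ VsetE (zigzagE a b x y k)) :
    v = a ∨ v = b ∨ ∃ i < k, (Even i ∧ v = x i) ∨ (¬ Even i ∧ v = y i) := by
  obtain ⟨i, hi, rfl⟩ := (mem_VsetE_image (by omega) _ _).1 hv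
  unfold zigzag
  split_ifs with h0 h1 h2
  · exact Or.inl rfl
  · exact Or.inr (Or.inl rfl)
  · refine Or.inr (Or.inr ⟨i - 1, by omega, Or.inr ⟨?_, rfl⟩⟩)
    grind
  · refine Or.inr (Or.inr ⟨i - 1, by omega, Or.inl ⟨?_, rfl⟩⟩)
    grind

theorem VsetE_zigzagE_inter {a b c d : V} {x y : ℕ → V} {k : ℕ} (hac : a ≠ c) (had : a ≠ d)
    (hbc : b ≠ c) (hx : ∀ i < k, ∀ j < k, x i = x j → i = j)
    (hy : ∀ i < k, ∀ j < k, y i = y j → i = j) (hxy : ∀ i < k, ∀ j < k, x i ≠ y j)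
    (ha : ∀ i < k, a ≠ x i ∧ a ≠ y i) (hb : ∀ i < k, b ≠ x i ∧ b ≠ y i)
    (hc : ∀ i < k, c ≠ x i ∧ c ≠ y i) (hd : ∀ i < k, d ≠ x i ∧ d ≠ y i)
    {v : V} (h : v ∈ VsetE (zigzagE a b x y k)) (h' : v ∈ VsetE (zigzagE c d y x k)) :
    v = b ∧ v = d := by
  rcases mem_VsetE_zigzagE h with h | h | ⟨i, hi, h⟩ <;>
  rcases mem_VsetE_zigzagE h' with h' | h' | ⟨j, hj, h'⟩ <;> grind

theorem linkE_union_linkE (a b c d : V) (x y : ℕ → V) (k : ℕ) :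
    linkE a b x y k ∪ linkE d c y x k =
      zigzagE b (if Even k then a else d) x y k ∪ zigzagE c (if Even k then d else a) y x k := by
  ext e
  simp only [linkE, zigzagE, Finset.mem_union, Finset.mem_image, Finset.mem_range,
    ← exists_or, ← and_or_left]
  refine exists_congr fun i => and_congr_right fun hi => ?_
  unfold zigzag
  by_cases h0 : i = 0 <;> by_cases hk : i = k <;> by_cases hi' : Even i <;> grind

theorem linkE_inter_linkE {a b c d : V} {x y : ℕ → V} {k : ℕ} (hac : a ≠ c) (hbc : b ≠ c)
    (hbd : b ≠ d)
    (hx : ∀ i < k, ∀ j < k, x i = x j → i = j)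
    (hy : ∀ i < k, ∀ j < k, y i = y j → i = j) (hxy : ∀ i < k, ∀ j < k, x i ≠ y j)
    (ha : ∀ i < k, a ≠ x i ∧ a ≠ y i) (hb : ∀ i < k, b ≠ x i ∧ b ≠ y i)
    (hc : ∀ i < k, c ≠ x i ∧ c ≠ y i) (hd : ∀ i < k, d ≠ x i ∧ d ≠ y i) :
    linkE a b x y k ∩ linkE d c y x k = ∅ := by
  rw [← Finset.disjoint_iff_inter_eq_empty, Finset.disjoint_left]
  intro e he he'
  simp only [linkE, Finset.mem_image, Finset.mem_range] at he he'
  obtain ⟨i, hi, rfl⟩ := he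
  obtain ⟨j, hj, h⟩ := he'
  rw [Sym2.eq_iff] at h
  have hy1 := hy (i - 1)
  have hx1 := hx (j - 1)
  have hxy1 := hxy (j - 1)
  have hxy2 := hxy i
  grind

theorem stmt10 (S1' S2' P1' P2' : Finset (Sym2 V)) (k : ℕ)
    (Q' : ℕ → Finset (Sym2 V)) (x' y' : ℕ → V) (v1 v2 v4 v5 : V)
    (hS1 : IsPathCoverE S1') (hS2 : IsPathCoverE S2')
    (hk : 1 ≤ k)
    (hQ : ∀ i < k, IsPathE (Q' i) (x' i) (y' i))
    (hQdisj : ∀ i < k, ∀ j < k, i ≠ j → Disjoint (VsetE (Q' i)) (VsetE (Q' j)))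
    (hP1 : IsPathE P1' v1 v2) (hP2 : IsPathE P2' v4 v5)
    (hVP : VsetE P1' = VsetE P2')
    (hPS1 : ∀ R : Finset (Sym2 V), MaxPathE S1' R ↔ (R = P1' ∨ ∃ i < k, R = Q' i))
    (hPS2 : ∀ R : Finset (Sym2 V), MaxPathE S2' R ↔ (R = P2' ∨ ∃ i < k, R = Q' i))
    (hv2 : v2 ≠ v4 ∧ v2 ≠ v5) (hv4 : v4 ≠ v1 ∧ v4 ≠ v2) :
    ∃ A1' A2' : Finset (Sym2 V),
      A1' ∩ A2' = ∅ ∧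
      IsTourE (S1' ∪ A1') ∧ IsTourE (S2' ∪ A2') ∧
      VsetE A1' = V1E S1' ∧ VsetE A2' = V1E S2' ∧
      s(v2, x' 0) ∈ A1' ∧ s(v4, y' 0) ∈ A2' ∧
      (v5 = v1 → IsPathE (A1' ∪ A2') v2 v4) ∧
      (v5 ≠ v1 → Odd k →
        ∃ R1 R2 : Finset (Sym2 V), IsPathE R1 v1 v4 ∧ IsPathE R2 v2 v5 ∧
          Disjoint (VsetE R1) (VsetE R2) ∧ A1' ∪ A2' = R1 ∪ R2) ∧
      (v5 ≠ v1 → Even k →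
        ∃ R1 R2 : Finset (Sym2 V), IsPathE R1 v1 v2 ∧ IsPathE R2 v4 v5 ∧
          Disjoint (VsetE R1) (VsetE R2) ∧ A1' ∪ A2' = R1 ∪ R2) := by
  have hMP1 := (hPS1 P1').2 (Or.inl rfl)
  have hMP2 := (hPS2 P2').2 (Or.inl rfl)
  have hPQ1 : ∀ i < k, Disjoint (VsetE P1') (VsetE (Q' i)) := by
    intro i hi
    rw [Set.disjoint_left]
    intro v hv hv'
    have h1 := hMP1.eq_of_mem ((hPS1 (Q' i)).2 (Or.inr ⟨i, hi, rfl⟩)) hv hv'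
    have h2 := hMP2.eq_of_mem ((hPS2 (Q' i)).2 (Or.inr ⟨i, hi, rfl⟩)) (hVP ▸ hv) hv'
    rw [h2, ← h1] at hP2
    have := (hP2.degE_eq_one_iff hP1.right_mem).1
      ((hP1.degE_eq_one_iff hP1.right_mem).2 (Or.inr rfl))
    tauto
  have hPQ2 : ∀ i < k, Disjoint (VsetE P2') (VsetE (Q' i)) := hVP ▸ hPQ1
  have hxQ : ∀ i < k, x' i ∈ VsetE (Q' i) := fun i hi => (hQ i hi).left_mem
  have hyQ : ∀ i < k, y' i ∈ VsetE (Q' i) := fun i hi => (hQ i hi).right_mem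
  have index_eq : ∀ i < k, ∀ j < k, ∀ v ∈ VsetE (Q' i), v ∈ VsetE (Q' j) → i = j := by
    intro i hi j hj v hv hv'
    by_contra hij
    exact Set.disjoint_left.1 (hQdisj i hi j hj hij) hv hv'
  have hx : ∀ i < k, ∀ j < k, x' i = x' j → i = j := fun i hi j hj h =>
    index_eq i hi j hj _ (hxQ i hi) (h ▸ hxQ j hj)
  have hy : ∀ i < k, ∀ j < k, y' i = y' j → i = j := fun i hi j hj h =>
    index_eq i hi j hj _ (hyQ i hi) (h ▸ hyQ j hj)
  have hxy : ∀ i < k, ∀ j < k, x' i ≠ y' j := by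
    intro i hi j hj h
    obtain rfl := index_eq i hi j hj _ (hxQ i hi) (h ▸ hyQ j hj)
    exact (hQ i hi).ne h
  have hout : ∀ v ∈ VsetE P1', ∀ i < k, v ≠ x' i ∧ v ≠ y' i := by
    refine fun v hv i hi => ⟨?_, ?_⟩
    · rintro rfl
      exact Set.disjoint_left.1 (hPQ1 i hi) hv (hxQ i hi)
    · rintro rfl
      exact Set.disjoint_left.1 (hPQ1 i hi) hv (hyQ i hi)
  have h1 := hout v1 hP1.left_mem
  have h2 := hout v2 hP1.right_mem
  have h4 := hout v4 (hVP ▸ hP2.left_mem)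
  have h5 := hout v5 (hVP ▸ hP2.right_mem)
  have h12 := hP1.ne
  have h45 := hP2.ne
  obtain ⟨hT1, hV1⟩ := hS1.linkE_spec hPS1 hk hP1 hQ hQdisj hPQ1
  obtain ⟨hT2, hV2⟩ := hS2.linkE_spec hPS2 hk hP2.symm (fun i hi => (hQ i hi).symm) hQdisj hPQ2
  have hxy' : ∀ i < k, ∀ j < k, y' i ≠ x' j := fun i hi j hj => (hxy j hj i hi).symm
  have swap : ∀ {v : V}, (∀ i < k, v ≠ x' i ∧ v ≠ y' i) → ∀ i < k, v ≠ y' i ∧ v ≠ x' i :=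
    fun h i hi => (h i hi).symm
  refine ⟨linkE v1 v2 x' y' k, linkE v5 v4 y' x' k,
    linkE_inter_linkE hv4.1.symm hv2.1 hv2.2 hx hy hxy h1 h2 h4 h5,
    hT1, hT2, hV1, hV2, ?_, ?_, ?_, ?_, ?_⟩
  · exact Finset.mem_image.2 ⟨0, by simp, by simp [show 0 ≠ k by omega]⟩
  · exact Finset.mem_image.2 ⟨0, by simp, by simp [show 0 ≠ k by omega]⟩
  · rintro rfl
    rw [linkE_union_linkE, ite_self]
    refine (isPathE_zigzagE h12.symm hx hy hxy h2 h1).trans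
      (isPathE_zigzagE hv4.1 hy hx hxy' (swap h4) (swap h1)).symm fun v hv hv' => ?_
    exact (VsetE_zigzagE_inter hv2.1 h12.symm hv4.1.symm hx hy hxy h2 h1 h4 h1 hv hv').1
  · intro h51 hodd
    have hne : ¬ Even k := Nat.not_even_iff_odd.2 hodd
    refine ⟨_, _, (isPathE_zigzagE hv4.1 hy hx hxy' (swap h4) (swap h1)).symm,
      isPathE_zigzagE hv2.2 hx hy hxy h2 h5, Set.disjoint_left.2 fun v hv hv' => ?_, ?_⟩
    · obtain ⟨e1, e2⟩ :=
        VsetE_zigzagE_inter hv2.1 h12.symm h45.symm hx hy hxy h2 h5 h4 h1 hv' hv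
      exact h51 (e1.symm.trans e2)
    · rw [linkE_union_linkE, if_neg hne, if_neg hne, Finset.union_comm]
  · intro h51 heven
    refine ⟨_, _, (isPathE_zigzagE h12.symm hx hy hxy h2 h1).symm,
      isPathE_zigzagE h45 hy hx hxy' (swap h4) (swap h5),
      Set.disjoint_left.2 fun v hv hv' => ?_, ?_⟩
    · obtain ⟨e1, e2⟩ :=
        VsetE_zigzagE_inter hv2.1 hv2.2 hv4.1.symm hx hy hxy h2 h1 h4 h5 hv hv'
      exact h51 (e2.symm.trans e1)
    · rw [linkE_union_linkE, if_pos heven, if_pos heven]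
end
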